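/- Let λ ≥ 0 and ε > 0. Assume L̄ is differentiable on (λ, λ+ε) and that sup{L̄'(t) : t ∈ (λ, λ+ε)} is not attained; if λ = 0 and L̄'_r(0⁺) = −∞, assume further that L̄ is right continuous at zero. Then for every real z ∈ [L̄'_r(λ⁺), L̄'_l(λ+ε)) there exists t_z ∈ [λ, λ+ε) with L̄'_r(t_z⁺) = z, and for every such t_z, every net (x_{α,z}) in [-∞,+∞] converging to z and every net (y_{α,z}) in [-∞,+∞] with liminf_α y_{α,z} > z, one has limsup_α c_α·log μ_α([x_{α,z}, y_{α,z}]) = limsup_α c_α·log μ_α((x_{α,z}, y_{α,z})) = L̄(t_z⁺) − t_z·z = −L̄*(z) = inf_{t>0}( L̄(t) − t·z ). -/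

import Mathlib

open Filter MeasureTheory Set Topology

noncomputable section

/-- `c · log m` as an extended real number, where `m ∈ [0,∞]`. -/
def elog (c : ℝ) (m : ENNReal) : EReal := (c : EReal) * ENNReal.log m

/-- The generalized log-moment generating function `L̄` associated with the net
`(μ_α, c_α)` indexed by the filter `lf`:
`L̄(t) = limsup_α c_α · log ∫ exp(t·x/c_α) dμ_α(x)`. -/
def genLogMGF {ι : Type*} (lf : Filter ι) (μ : ι → Measure ℝ) (c : ι → ℝ) (t : ℝ) : EReal :=
  Filter.limsup
    (fun i => elog (c i) (∫⁻ x : ℝ, ENNReal.ofReal (Real.exp (t * x / c i)) ∂ (μ i))) lf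

/-- Legendre–Fenchel transform of an `EReal`-valued function on `ℝ`, evaluated at an
extended real argument: `L*(x) = sup_t (t·x − L(t))`. -/
def LegendreEE (L : ℝ → EReal) (x : EReal) : EReal := ⨆ t : ℝ, ((t : EReal) * x - L t)

open Classical in
/-- The right derivative of a convex `EReal`-valued function at `t`, with the conventions
`L'_r(t) = +∞` when `L(s) = +∞` for all `s > t` and `L'_r(t) = -∞` when `L(s) = -∞` for
some `s > t`; otherwise it is the infimum of the right difference quotients. -/
def rightDerivE (L : ℝ → EReal) (t : ℝ) : EReal :=
  if ∀ s : ℝ, t < s → L s = ⊤ then ⊤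
  else if ∃ s : ℝ, t < s ∧ L s = ⊥ then ⊥
  else ⨅ s ∈ Set.Ioi t, (L s - L t) * (((s - t)⁻¹ : ℝ) : EReal)

/-- The left derivative of a convex `EReal`-valued function at `t` (supremum of left
difference quotients). -/
def leftDerivE (L : ℝ → EReal) (t : ℝ) : EReal :=
  ⨆ s ∈ Set.Iio t, (L t - L s) * (((t - s)⁻¹ : ℝ) : EReal)

/-- Right limit at `a` of an `EReal`-valued function (as a `limsup`; it coincides with
`lim_{t→a⁺} f(t)` whenever the latter exists, e.g. for monotone or convex `f`). -/
def rightLimE (f : ℝ → EReal) (a : ℝ) : EReal := Filter.limsup f (nhdsWithin a (Set.Ioi a))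

/-- Left limit at `a` of an `EReal`-valued function (as a `limsup`; it coincides with
`lim_{t→a⁻} f(t)` whenever the latter exists). -/
def leftLimE (f : ℝ → EReal) (a : ℝ) : EReal := Filter.limsup f (nhdsWithin a (Set.Iio a))

/-- `L` is affine on the interval `(a, b]`. -/
def AffineOnIoc (L : ℝ → EReal) (a b : ℝ) : Prop :=
  ∃ p q : ℝ, ∀ s ∈ Set.Ioc a b, L s = ((p * s + q : ℝ) : EReal)

/-- `λ̃ = sup {t > λ : L is affine on (λ, t]}` (equal to `λ` if there is no such `t`). -/
def tildeOf (L : ℝ → EReal) (lam : ℝ) : ℝ :=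
  sSup (insert lam {t : ℝ | lam < t ∧ AffineOnIoc L lam t})

/-- Differentiability at `t` of an `EReal`-valued function: `L(t)` is finite and the
difference quotients converge to a (finite) real number. -/
def EDifferentiableAt (L : ℝ → EReal) (t : ℝ) : Prop :=
  (∃ r : ℝ, L t = (r : EReal)) ∧
  ∃ d : ℝ, Filter.Tendsto (fun s => (L s - L t) * (((s - t)⁻¹ : ℝ) : EReal))
    (nhdsWithin t {t}ᶜ) (nhds (d : EReal))

/-- The function `l₀(x) = − lim_{ε→0⁺} limsup_α c_α · log μ_α((x−ε, x+ε))` (the limit over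
`ε` exists by monotonicity and equals the infimum). -/
def l0fun {ι : Type*} (lf : Filter ι) (μ : ι → Measure ℝ) (c : ι → ℝ) (x : ℝ) : EReal :=
  - ⨅ ε ∈ Set.Ioi (0:ℝ),
      Filter.limsup (fun i => elog (c i) (μ i (Set.Ioo (x - ε) (x + ε)))) lf

/-- `L` restricted to `[0,∞)` is proper: `(−∞,+∞]`-valued with at least one finite value. -/
def LbarProper (L : ℝ → EReal) : Prop :=
  (∀ t : ℝ, 0 ≤ t → L t ≠ ⊥) ∧ ∃ t : ℝ, 0 ≤ t ∧ L t ≠ ⊤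

/-- `μ([x, y])` for extended-real endpoints `x, y`, with `μ` regarded as a measure on
`[-∞, +∞]`. -/
def muIccE (μ : Measure ℝ) (x y : EReal) : ENNReal :=
  μ {z : ℝ | x ≤ (z : EReal) ∧ (z : EReal) ≤ y}

/-- `μ((x, y))` for extended-real endpoints `x, y`. -/
def muIooE (μ : Measure ℝ) (x y : EReal) : ENNReal :=
  μ {z : ℝ | x < (z : EReal) ∧ (z : EReal) < y}

open Classical in
/-- The Legendre transform extended to `[-∞,+∞]` by continuity, with the paper's
convention `L̄*(−∞) = −L̄(0⁺)`. -/
def LegendreExt (L : ℝ → EReal) (x : EReal) : EReal :=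
  if x = ⊥ then -(rightLimE L 0) else if x = ⊤ then ⊤ else LegendreEE L x

end


theorem elog_le_coe_iff {c a : ℝ} (hc : 0 < c) (m : ENNReal) :
    elog c m ≤ (a : EReal) ↔ m ≤ ENNReal.ofReal (Real.exp (a / c)) := by
  have hlog : ENNReal.log (ENNReal.ofReal (Real.exp (a / c))) = ((a / c : ℝ) : EReal) := by
    rw [ENNReal.log_ofReal, if_neg (not_le.2 (Real.exp_pos _)), Real.log_exp]
  rw [← ENNReal.log_le_log_iff, hlog, EReal.coe_div,
    EReal.le_div_iff_mul_le (by exact_mod_cast hc) (EReal.coe_ne_top c), mul_comm]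
  rfl

theorem elog_mono {c : ℝ} (hc : 0 < c) {m n : ENNReal} (h : m ≤ n) : elog c m ≤ elog c n :=
  mul_le_mul_of_nonneg_left (ENNReal.log_le_log_iff.2 h) (by exact_mod_cast hc.le)

theorem measurable_ofReal_exp (t c : ℝ) :
    Measurable fun x : ℝ => ENNReal.ofReal (Real.exp (t * x / c)) := by
  fun_prop

section LogMoment

variable {ι : Type*} {lf : Filter ι} {μ : ι → Measure ℝ} {c : ι → ℝ}

theorem eventually_lintegral_le (hc : ∀ i, 0 < c i) {t a : ℝ}
    (h : genLogMGF lf μ c t < (a : EReal)) :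
    ∀ᶠ i in lf, ∫⁻ x : ℝ, ENNReal.ofReal (Real.exp (t * x / c i)) ∂(μ i)
      ≤ ENNReal.ofReal (Real.exp (a / c i)) := by
  filter_upwards [Filter.eventually_lt_of_limsup_lt h] with i hi
  exact (elog_le_coe_iff (hc i) _).1 hi.le

theorem genLogMGF_convex (hc : ∀ i, 0 < c i) {s t a b p q : ℝ}
    (hs : genLogMGF lf μ c s < (a : EReal)) (ht : genLogMGF lf μ c t < (b : EReal))
    (hp : 0 ≤ p) (hq : 0 ≤ q) (hpq : p + q = 1) :
    genLogMGF lf μ c (p * s + q * t) ≤ ((p * a + q * b : ℝ) : EReal) := by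
  refine Filter.limsup_le_of_le (h := ?_)
  filter_upwards [eventually_lintegral_le hc hs, eventually_lintegral_le hc ht] with i his hit
  rw [elog_le_coe_iff (hc i)]
  have hrpow : ∀ u v p : ℝ, ENNReal.ofReal (Real.exp u) ^ p * ENNReal.ofReal (Real.exp v) ^ q
      = ENNReal.ofReal (Real.exp (p * u + q * v)) := by
    intro u v p
    rw [ENNReal.ofReal_rpow_of_pos (Real.exp_pos _), ENNReal.ofReal_rpow_of_pos (Real.exp_pos _),
      ← ENNReal.ofReal_mul (Real.rpow_nonneg (Real.exp_pos _).le _), ← Real.exp_mul,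
      ← Real.exp_mul, ← Real.exp_add, mul_comm u, mul_comm v]
  have holder := ENNReal.lintegral_mul_norm_pow_le (μ := μ i)
    (measurable_ofReal_exp s (c i)).aemeasurable (measurable_ofReal_exp t (c i)).aemeasurable
    hp hq hpq
  simp only [hrpow] at holder
  calc ∫⁻ x : ℝ, ENNReal.ofReal (Real.exp ((p * s + q * t) * x / c i)) ∂(μ i)
      = ∫⁻ x : ℝ, ENNReal.ofReal (Real.exp (p * (s * x / c i) + q * (t * x / c i))) ∂(μ i) := by
        refine lintegral_congr fun x => ?_
        congr 2
        ring
    _ ≤ _ := holder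
    _ ≤ ENNReal.ofReal (Real.exp (a / c i)) ^ p * ENNReal.ofReal (Real.exp (b / c i)) ^ q :=
        mul_le_mul' (ENNReal.rpow_le_rpow his hp) (ENNReal.rpow_le_rpow hit hq)
    _ = ENNReal.ofReal (Real.exp ((p * a + q * b) / c i)) := by
        rw [hrpow]
        congr 2
        ring

/-- Exponential Chebyshev bound. -/
theorem limsup_elog_Icc_le (hc : ∀ i, 0 < c i) {x y : ι → EReal} {t a b : ℝ} (ht : 0 ≤ t)
    (hL : genLogMGF lf μ c t < (b : EReal)) (hx : ∀ᶠ i in lf, (a : EReal) < x i) :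
    limsup (fun i => elog (c i) (muIccE (μ i) (x i) (y i))) lf ≤ ((b - t * a : ℝ) : EReal) := by
  refine Filter.limsup_le_of_le (h := ?_)
  filter_upwards [eventually_lintegral_le hc hL, hx] with i hi hxi
  rw [elog_le_coe_iff (hc i)]
  have hsub : {z : ℝ | x i ≤ (z : EReal) ∧ (z : EReal) ≤ y i} ⊆ Ici a := fun z hz =>
    EReal.coe_le_coe_iff.1 (hxi.le.trans hz.1)
  calc muIccE (μ i) (x i) (y i) ≤ μ i (Ici a) := measure_mono hsub
    _ = ∫⁻ u : ℝ, (Ici a).indicator 1 u ∂(μ i) := (lintegral_indicator_one measurableSet_Ici).symm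
    _ ≤ ∫⁻ u : ℝ, ENNReal.ofReal (Real.exp (-(t * a) / c i)) *
          ENNReal.ofReal (Real.exp (t * u / c i)) ∂(μ i) := by
        refine lintegral_mono fun u => ?_
        by_cases hu : u ∈ Ici a
        swap
        · simp [Set.indicator_of_notMem hu]
        rw [Set.indicator_of_mem hu, ← ENNReal.ofReal_mul (Real.exp_pos _).le, ← Real.exp_add, Pi.one_apply,
          ENNReal.one_le_ofReal, Real.one_le_exp_iff, ← add_div]
        have := mul_le_mul_of_nonneg_left (mem_Ici.1 hu) ht
        exact div_nonneg (by linarith) (hc i).le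
    _ = ENNReal.ofReal (Real.exp (-(t * a) / c i)) *
          ∫⁻ u : ℝ, ENNReal.ofReal (Real.exp (t * u / c i)) ∂(μ i) :=
        lintegral_const_mul _ (measurable_ofReal_exp t (c i))
    _ ≤ ENNReal.ofReal (Real.exp (-(t * a) / c i)) * ENNReal.ofReal (Real.exp (b / c i)) := by
        gcongr
    _ = ENNReal.ofReal (Real.exp ((b - t * a) / c i)) := by
        rw [← ENNReal.ofReal_mul (Real.exp_pos _).le, ← Real.exp_add]
        congr 2
        ring

/-- Splitting the exponential moment at `t` over `(-∞, a]`, `(a, b)` and `[b, ∞)`. -/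
theorem lintegral_exp_le_split (ν : Measure ℝ) {k : ℝ} (hk : 0 < k) {u t v a b : ℝ}
    (ht : 0 ≤ t) (hut : u ≤ t) (htv : t ≤ v) :
    ∫⁻ x : ℝ, ENNReal.ofReal (Real.exp (t * x / k)) ∂ν ≤
      ENNReal.ofReal (Real.exp ((t - u) * a / k)) *
          ∫⁻ x : ℝ, ENNReal.ofReal (Real.exp (u * x / k)) ∂ν
        + ENNReal.ofReal (Real.exp (-((v - t) * b) / k)) *
          ∫⁻ x : ℝ, ENNReal.ofReal (Real.exp (v * x / k)) ∂ν
        + ENNReal.ofReal (Real.exp (t * b / k)) * ν (Ioo a b) := by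
  rw [← lintegral_const_mul _ (measurable_ofReal_exp u k),
    ← lintegral_const_mul _ (measurable_ofReal_exp v k),
    ← lintegral_indicator_one measurableSet_Ioo,
    ← lintegral_const_mul _ (measurable_one.indicator measurableSet_Ioo),
    ← lintegral_add_left ((measurable_ofReal_exp u k).const_mul _),
    ← lintegral_add_right _ ((measurable_one.indicator measurableSet_Ioo).const_mul _)]
  refine lintegral_mono fun x => ?_
  have hexp : ∀ {w w' : ℝ}, w ≤ w' →
      ENNReal.ofReal (Real.exp (w / k)) ≤ ENNReal.ofReal (Real.exp (w' / k)) := fun h => by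
    gcongr
  simp only [← ENNReal.ofReal_mul (Real.exp_pos _).le, ← Real.exp_add, ← add_div]
  rcases le_or_gt x a with hxa | hax
  · refine le_trans (hexp ?_) (le_add_right (le_add_right le_rfl))
    nlinarith
  rcases le_or_gt b x with hbx | hxb
  · refine le_trans (hexp ?_) (le_add_right (le_add_left le_rfl))
    nlinarith
  · refine le_trans (hexp (w' := t * b) ?_) (le_add_left (le_of_eq ?_))
    · nlinarith
    · simp [Set.indicator_of_mem (show x ∈ Ioo a b from ⟨hax, hxb⟩)]

theorem le_limsup_elog_Ioo [lf.NeBot] (hc : ∀ i, 0 < c i) (hc0 : Tendsto c lf (𝓝 0))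
    {u t v a b fu f fv : ℝ} (ht : 0 ≤ t) (hut : u ≤ t) (htv : t ≤ v)
    (hLu : genLogMGF lf μ c u = (fu : EReal)) (hLt : genLogMGF lf μ c t = (f : EReal))
    (hLv : genLogMGF lf μ c v = (fv : EReal))
    (hu : fu + (t - u) * a < f) (hv : fv - (v - t) * b < f) :
    ((f - t * b : ℝ) : EReal) ≤ limsup (fun i => elog (c i) (μ i (Ioo a b))) lf := by
  by_contra! hlt
  obtain ⟨w, hw, hwf⟩ := EReal.lt_iff_exists_real_btwn.1 hlt
  rw [EReal.coe_lt_coe_iff] at hwf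
  obtain ⟨K, hK, hKf⟩ := exists_between
    (max_lt (max_lt hu hv) (show w + t * b < f by linarith))
  obtain ⟨⟨hK1, hK2⟩, hK3⟩ : (fu + (t - u) * a < K ∧ fv - (v - t) * b < K) ∧ w + t * b < K := by
    simpa [max_lt_iff] using hK
  have hlog3 : 0 < Real.log 3 := Real.log_pos (by norm_num)
  have hsmall : ∀ᶠ i in lf, c i < (f - K) / 2 / Real.log 3 :=
    hc0.eventually_lt_const (div_pos (by linarith) hlog3)
  have hupper : genLogMGF lf μ c t ≤ (((f + K) / 2 : ℝ) : EReal) := by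
    refine Filter.limsup_le_of_le (h := ?_)
    have hLu' : genLogMGF lf μ c u < ((K - (t - u) * a : ℝ) : EReal) := by
      rw [hLu, EReal.coe_lt_coe_iff]; linarith
    have hLv' : genLogMGF lf μ c v < ((K + (v - t) * b : ℝ) : EReal) := by
      rw [hLv, EReal.coe_lt_coe_iff]; linarith
    filter_upwards [eventually_lintegral_le hc hLu', eventually_lintegral_le hc hLv',
      Filter.eventually_lt_of_limsup_lt hw, hsmall] with i hiu hiv hiw hci
    have hk := hc i
    rw [elog_le_coe_iff hk]
    replace hiw := (elog_le_coe_iff hk _).1 hiw.le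
    have hmul : ∀ {x y z : ℝ} {m : ENNReal}, m ≤ ENNReal.ofReal (Real.exp (y / c i)) →
        x + y ≤ z → ENNReal.ofReal (Real.exp (x / c i)) * m
          ≤ ENNReal.ofReal (Real.exp (z / c i)) := by
      intro x y z m hm hz
      refine (mul_le_mul_right hm _).trans ?_
      rw [← ENNReal.ofReal_mul (Real.exp_pos _).le, ← Real.exp_add, ← add_div]
      gcongr
    refine (lintegral_exp_le_split (μ i) hk (a := a) (b := b) ht hut htv).trans ?_
    refine (add_le_add (add_le_add (hmul (z := K) hiu (by linarith))
      (hmul (z := K) hiv (by linarith))) (hmul (z := K) hiw (by linarith))).trans ?_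
    rw [← ENNReal.ofReal_add (Real.exp_pos _).le (Real.exp_pos _).le,
      ← ENNReal.ofReal_add (by positivity) (Real.exp_pos _).le]
    refine ENNReal.ofReal_le_ofReal ?_
    calc Real.exp (K / c i) + Real.exp (K / c i) + Real.exp (K / c i)
        = Real.exp (Real.log 3 + K / c i) := by
          rw [Real.exp_add, Real.exp_log (by norm_num)]; ring
      _ ≤ Real.exp ((f + K) / 2 / c i) := by
          rw [Real.exp_le_exp, le_div_iff₀ hk, add_mul, div_mul_cancel₀ _ hk.ne']
          rw [lt_div_iff₀ hlog3] at hci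
          linarith
  rw [hLt, EReal.coe_le_coe_iff] at hupper
  linarith

end LogMoment

section Convex

variable {L : ℝ → EReal} {f : ℝ → ℝ} {s d : ℝ}

theorem hasDerivAt_of_tendsto_quotient (hf : ∀ᶠ u in 𝓝 s, L u = (f u : EReal))
    (hd : Tendsto (fun u => (L u - L s) * (((u - s)⁻¹ : ℝ) : EReal)) (𝓝[≠] s) (𝓝 (d : EReal))) :
    HasDerivAt f d s := by
  rw [hasDerivAt_iff_tendsto_slope, ← EReal.tendsto_coe]
  refine hd.congr' ?_
  filter_upwards [hf.filter_mono nhdsWithin_le_nhds] with u hu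
  rw [hu, hf.self_of_nhds, slope_def_field, div_eq_mul_inv, EReal.coe_mul, EReal.coe_sub]

/-- Subgradient inequality for a convex function finite near `s`. -/
theorem subgradient_le
    (hconv : ∀ {s t a b p q : ℝ}, L s < (a : EReal) → L t < (b : EReal) → 0 ≤ p → 0 ≤ q →
      p + q = 1 → L (p * s + q * t) ≤ ((p * a + q * b : ℝ) : EReal))
    (hf : ∀ᶠ u in 𝓝 s, L u = (f u : EReal)) (hd : HasDerivAt f d s) (t : ℝ) :
    ((f s + d * (t - s) : ℝ) : EReal) ≤ L t := by
  refine EReal.le_of_forall_lt_iff_le.1 fun b hb => ?_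
  rw [EReal.coe_le_coe_iff]
  have hline : HasDerivAt (fun θ : ℝ => s + θ * (t - s)) (t - s) 0 := by
    simpa using ((hasDerivAt_id (0 : ℝ)).mul_const (t - s)).const_add s
  have hcomp : HasDerivAt (fun θ : ℝ => f (s + θ * (t - s))) (d * (t - s)) 0 :=
    HasDerivAt.comp (h₂ := f) 0 (by simpa using hd) hline
  have hnear : ∀ᶠ θ in 𝓝[>] (0 : ℝ), L (s + θ * (t - s)) = (f (s + θ * (t - s)) : EReal) := by
    have hcont : Tendsto (fun θ : ℝ => s + θ * (t - s)) (𝓝 0) (𝓝 s) := by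
      simpa using hline.continuousAt.tendsto
    exact (hcont.eventually hf).filter_mono nhdsWithin_le_nhds
  have hle : d * (t - s) ≤ b - f s := by
    refine le_of_tendsto hcomp.tendsto_slope_zero_right ?_
    filter_upwards [hnear, Ioo_mem_nhdsGT (zero_lt_one : (0 : ℝ) < 1)] with θ hθ ⟨h0, h1⟩
    have key : f (s + θ * (t - s)) ≤ (1 - θ) * f s + θ * b := by
      refine le_of_forall_gt_imp_ge_of_dense fun w hw => ?_
      have ha : f s < f s + (w - ((1 - θ) * f s + θ * b)) := by linarith
      have := hconv (s := s) (t := t) (a := f s + (w - ((1 - θ) * f s + θ * b))) (b := b)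
        (by rw [hf.self_of_nhds]; exact_mod_cast ha) hb (sub_nonneg.2 h1.le) h0.le (by ring)
      rw [show (1 - θ) * s + θ * t = s + θ * (t - s) by ring, hθ, EReal.coe_le_coe_iff] at this
      nlinarith
    simp only [zero_add, zero_mul, add_zero, smul_eq_mul]
    rw [inv_mul_le_iff₀ h0]
    linarith
  linarith

theorem rightDerivE_eq (hf : ∀ᶠ u in 𝓝 s, L u = (f u : EReal)) (hd : HasDerivAt f d s)
    (hsub : ∀ t, ((f s + d * (t - s) : ℝ) : EReal) ≤ L t) : rightDerivE L s = (d : EReal) := by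
  have hright : ∀ᶠ u in 𝓝[>] s, L u = (f u : EReal) ∧ s < u :=
    (hf.filter_mono nhdsWithin_le_nhds).and self_mem_nhdsWithin
  rw [rightDerivE, if_neg, if_neg]
  · refine le_antisymm ?_ (le_iInf₂ fun u hu => ?_)
    · have hslope : Tendsto (fun u => ((slope f s u : ℝ) : EReal)) (𝓝[>] s) (𝓝 (d : EReal)) :=
        EReal.tendsto_coe.2 ((hasDerivAt_iff_tendsto_slope.1 hd).mono_left
          (nhdsWithin_mono _ fun u hu => (mem_Ioi.1 hu).ne'))
      refine ge_of_tendsto hslope ?_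
      filter_upwards [hright] with u ⟨hu, hsu⟩
      refine (iInf₂_le u hsu).trans_eq ?_
      rw [hu, hf.self_of_nhds, slope_def_field, div_eq_mul_inv, EReal.coe_mul, EReal.coe_sub]
    · have hpos : 0 < (u - s)⁻¹ := inv_pos.2 (sub_pos.2 hu)
      have hdiff : ((d * (u - s) : ℝ) : EReal) ≤ L u - L s := by
        rw [hf.self_of_nhds, EReal.le_sub_iff_add_le (.inl (EReal.coe_ne_bot _))
          (.inl (EReal.coe_ne_top _)), ← EReal.coe_add, add_comm]
        exact hsub u
      calc (d : EReal) = ((d * (u - s) : ℝ) : EReal) * (((u - s)⁻¹ : ℝ) : EReal) := by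
            rw [← EReal.coe_mul, mul_inv_cancel_right₀ (sub_pos.2 hu).ne']
        _ ≤ _ := mul_le_mul_of_nonneg_right hdiff (by exact_mod_cast hpos.le)
  · rintro ⟨u, -, hu⟩
    exact EReal.coe_ne_bot _ (le_bot_iff.1 (hu ▸ hsub u))
  · intro htop
    obtain ⟨u, hu, hsu⟩ := hright.exists
    exact EReal.coe_ne_top _ (hu.symm.trans (htop u hsu))

theorem legendreEE_eq_of_tendsto {tz z r : ℝ} {l : Filter ℝ} [l.NeBot]
    (hle : ∀ t : ℝ, ((r + t * z : ℝ) : EReal) ≤ L t) (hf : ∀ᶠ u in l, L u = (f u : EReal))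
    (hid : Tendsto id l (𝓝 tz)) (hlim : Tendsto f l (𝓝 (r + tz * z))) :
    LegendreEE L z = ((-r : ℝ) : EReal) := by
  refine le_antisymm (iSup_le fun t => ?_) ?_
  · refine EReal.sub_le_of_le_add ?_
    calc (t : EReal) * z = ((-r : ℝ) : EReal) + ((r + t * z : ℝ) : EReal) := by
          rw [← EReal.coe_add, ← EReal.coe_mul]; congr 1; ring
      _ ≤ _ := by gcongr; exact hle t
  · have hlim' : Tendsto (fun t => t * z - f t) l (𝓝 (-r)) := by
      have := (hid.mul_const z).sub hlim
      rwa [show tz * z - (r + tz * z) = -r by ring] at this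
    refine le_of_tendsto (EReal.tendsto_coe.2 hlim') ?_
    filter_upwards [hf] with t ht
    refine le_trans (le_of_eq ?_) (le_iSup _ t)
    rw [ht, EReal.coe_sub, EReal.coe_mul]

theorem iInf_sub_eq_of_tendsto {tz z r : ℝ} {l : Filter ℝ} [l.NeBot]
    (hle : ∀ t : ℝ, ((r + t * z : ℝ) : EReal) ≤ L t)
    (hf : ∀ᶠ u in l, L u = (f u : EReal) ∧ 0 < u)
    (hid : Tendsto id l (𝓝 tz)) (hlim : Tendsto f l (𝓝 (r + tz * z))) :
    ⨅ t ∈ Set.Ioi (0 : ℝ), (L t - (t : EReal) * (z : EReal)) = (r : EReal) := by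
  refine le_antisymm ?_ (le_iInf₂ fun t _ => ?_)
  · have hlim' : Tendsto (fun t => f t - t * z) l (𝓝 r) := by
      have := hlim.sub (hid.mul_const z)
      rwa [add_sub_cancel_right] at this
    refine ge_of_tendsto (EReal.tendsto_coe.2 hlim') ?_
    filter_upwards [hf] with t ⟨ht, ht0⟩
    refine (iInf₂_le t ht0).trans_eq ?_
    rw [ht, EReal.coe_sub, EReal.coe_mul]
  · rw [← EReal.coe_mul, EReal.le_sub_iff_add_le (.inl (EReal.coe_ne_bot _))
      (.inl (EReal.coe_ne_top _)), ← EReal.coe_add]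
    exact hle t

end Convex

section RealDerivative

variable {f d : ℝ → ℝ}

theorem monotoneOn_of_subgradient {S : Set ℝ}
    (h : ∀ s ∈ S, ∀ t ∈ S, f s + d s * (t - s) ≤ f t) : MonotoneOn d S := by
  intro s hs t ht hst
  rcases hst.eq_or_lt with rfl | hlt
  · rfl
  have h1 := h s hs t ht
  have h2 := h t ht s hs
  exact le_of_mul_le_mul_right (by linarith : d s * (t - s) ≤ d t * (t - s)) (sub_pos.2 hlt)

theorem tendsto_right_of_monotoneOn_hasDerivAt {a b m : ℝ}
    (hderiv : ∀ s ∈ Ioo a b, HasDerivAt f (d s) s) (hmono : MonotoneOn d (Ioo a b))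
    (hm : m ∈ Ioo a b) : Tendsto d (𝓝[>] m) (𝓝 (d m)) := by
  refine tendsto_order.2 ⟨fun w hw => ?_, fun w hw => ?_⟩
  · filter_upwards [Ioo_mem_nhdsGT hm.2] with v hv
    exact hw.trans_le (hmono hm ⟨hm.1.trans hv.1, hv.2⟩ hv.1.le)
  · obtain ⟨u, hu, hmu, huw⟩ : ∃ u ∈ Ioo a b, m < u ∧ d u < w := by
      obtain ⟨u, hmu, hub⟩ := exists_between hm.2
      have hu : u ∈ Ioo a b := ⟨hm.1.trans hmu, hub⟩
      rcases lt_or_ge (d u) w with huw | hwu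
      · exact ⟨u, hu, hmu, huw⟩
      obtain ⟨v, hmv, hvw⟩ := exists_between hw
      obtain ⟨q, hq, rfl⟩ : v ∈ d '' Ioo a b :=
        (ordConnected_Ioo.image_hasDerivWithinAt fun x hx =>
          (hderiv x hx).hasDerivWithinAt).out (mem_image_of_mem d hm) (mem_image_of_mem d hu)
          ⟨hmv.le, hvw.le.trans hwu⟩
      exact ⟨q, hq, hmono.reflect_lt hm hq hmv, hvw⟩
    filter_upwards [Ioo_mem_nhdsGT hmu] with v hv
    exact (hmono ⟨hm.1.trans hv.1, hv.2.trans hu.2⟩ hu hv.2.le).trans_lt huw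

theorem exists_left_lt_of_lt_deriv {t d a : ℝ} {S : Set ℝ} (hd : HasDerivAt f d t)
    (hS : S ∈ 𝓝 t) (had : a < d) : ∃ u ∈ S, u < t ∧ f u + (t - u) * a < f t := by
  have hlim : Tendsto (slope f t) (𝓝[<] t) (𝓝 d) :=
    (hasDerivAt_iff_tendsto_slope.1 hd).mono_left (nhdsWithin_mono _ fun u hu => (mem_Iio.1 hu).ne)
  obtain ⟨u, ⟨hu, huS⟩, hut⟩ := (((hlim.eventually_const_lt had).and
    (nhdsWithin_le_nhds hS)).and self_mem_nhdsWithin).exists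
  refine ⟨u, huS, hut, ?_⟩
  rw [slope_def_field, lt_div_iff_of_neg (sub_neg.2 hut)] at hu
  linarith

theorem exists_right_lt_of_deriv_lt {t d b : ℝ} {S : Set ℝ} (hd : HasDerivAt f d t)
    (hS : S ∈ 𝓝 t) (hdb : d < b) : ∃ v ∈ S, t < v ∧ f v - (v - t) * b < f t := by
  have hlim : Tendsto (slope f t) (𝓝[>] t) (𝓝 d) :=
    (hasDerivAt_iff_tendsto_slope.1 hd).mono_left (nhdsWithin_mono _ fun u hu => (mem_Ioi.1 hu).ne')
  obtain ⟨v, ⟨hv, hvS⟩, htv⟩ := (((hlim.eventually_lt_const hdb).and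
    (nhdsWithin_le_nhds hS)).and self_mem_nhdsWithin).exists
  refine ⟨v, hvS, htv, ?_⟩
  rw [slope_def_field, div_lt_iff₀ (sub_pos.2 htv)] at hv
  linarith

theorem tendsto_rightLimE_of_monotoneOn {g : ℝ → EReal} {a b : ℝ} (hab : a < b)
    (hg : MonotoneOn g (Ioo a b)) : Tendsto g (𝓝[>] a) (𝓝 (rightLimE g a)) := by
  have hlim := hg.tendsto_nhdsWithin_Ioo_right (nonempty_Ioo.2 hab) (OrderBot.bddBelow _)
  rwa [rightLimE, hlim.limsup_eq]

end RealDerivative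

theorem statement3
    {ι : Type*} (lf : Filter ι) [lf.NeBot]
    (μ : ι → Measure ℝ) [∀ i, IsProbabilityMeasure (μ i)]
    (c : ι → ℝ) (hc : ∀ i, 0 < c i) (hc0 : Filter.Tendsto c lf (nhds (0 : ℝ)))
    (L : ℝ → EReal) (hL : L = genLogMGF lf μ c)
    (lam : ℝ) (hlam : 0 ≤ lam) (eps : ℝ) (heps : 0 < eps)
    (hdiff : ∀ t ∈ Set.Ioo lam (lam + eps), EDifferentiableAt L t)
    (hsup : ∀ t ∈ Set.Ioo lam (lam + eps), ∃ s ∈ Set.Ioo lam (lam + eps),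
      rightDerivE L t < rightDerivE L s)
    (hrc : lam = 0 → rightLimE (rightDerivE L) 0 = ⊥ →
      Filter.Tendsto L (nhdsWithin 0 (Set.Ioi 0)) (nhds (0 : EReal)))
    :
    ∀ z : ℝ, rightLimE (rightDerivE L) lam ≤ (z : EReal) → (z : EReal) < leftLimE (rightDerivE L) (lam + eps) →
      (∃ tz ∈ Set.Ico lam (lam + eps), rightLimE (rightDerivE L) tz = (z : EReal)) ∧
      ∀ tz ∈ Set.Ico lam (lam + eps), rightLimE (rightDerivE L) tz = (z : EReal) →
        ∀ x y : ι → EReal, Filter.Tendsto x lf (nhds ((z : EReal))) →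
          (z : EReal) < Filter.liminf y lf →
          Filter.limsup (fun i => elog (c i) (muIccE (μ i) (x i) (y i))) lf
              = rightLimE L tz - (tz : EReal) * (z : EReal) ∧
          Filter.limsup (fun i => elog (c i) (muIooE (μ i) (x i) (y i))) lf
              = rightLimE L tz - (tz : EReal) * (z : EReal) ∧
          rightLimE L tz - (tz : EReal) * (z : EReal) = - LegendreEE L (z : EReal) ∧
          - LegendreEE L (z : EReal)
              = ⨅ t ∈ Set.Ioi (0:ℝ), (L t - (t : EReal) * (z : EReal)) := by
  subst hL
  set L := genLogMGF lf μ c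
  have hconv : ∀ {s t a b p q : ℝ}, L s < (a : EReal) → L t < (b : EReal) → 0 ≤ p → 0 ≤ q →
      p + q = 1 → L (p * s + q * t) ≤ ((p * a + q * b : ℝ) : EReal) := genLogMGF_convex hc
  choose! f hf using fun t ht => (hdiff t ht).1
  choose! d hd using fun t ht => (hdiff t ht).2
  have hnear : ∀ s ∈ Ioo lam (lam + eps), ∀ᶠ u in 𝓝 s, L u = (f u : EReal) := fun s hs =>
    Filter.mem_of_superset (isOpen_Ioo.mem_nhds hs) hf
  have hderiv : ∀ s ∈ Ioo lam (lam + eps), HasDerivAt f (d s) s := fun s hs =>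
    hasDerivAt_of_tendsto_quotient (hnear s hs) (hd s hs)
  have hsub : ∀ s ∈ Ioo lam (lam + eps), ∀ t, ((f s + d s * (t - s) : ℝ) : EReal) ≤ L t :=
    fun s hs => subgradient_le hconv (hnear s hs) (hderiv s hs)
  have hD : ∀ s ∈ Ioo lam (lam + eps), rightDerivE L s = (d s : EReal) := fun s hs =>
    rightDerivE_eq (hnear s hs) (hderiv s hs) (hsub s hs)
  have hdmono : MonotoneOn d (Ioo lam (lam + eps)) :=
    monotoneOn_of_subgradient fun s hs t ht => by
      simpa only [hf t ht, EReal.coe_le_coe_iff] using hsub s hs t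
  intro z hz hzlt
  obtain ⟨u₀, hu₀, hzu₀⟩ : ∃ u ∈ Ioo lam (lam + eps), z < d u := by
    obtain ⟨u, hu, huI⟩ := ((frequently_lt_of_lt_limsup (h := hzlt)).and_eventually
      (Ioo_mem_nhdsLT (by linarith : lam < lam + eps))).exists
    rw [hD u huI, EReal.coe_lt_coe_iff] at hu
    exact ⟨u, huI, hu⟩
  have hlimD : ∀ t ∈ Ico lam (lam + eps),
      Tendsto (rightDerivE L) (𝓝[>] t) (𝓝 (rightLimE (rightDerivE L) t)) := fun t ht =>
    tendsto_rightLimE_of_monotoneOn ht.2 fun x hx y hy hxy => by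
      have hx' : x ∈ Ioo lam (lam + eps) := ⟨ht.1.trans_lt hx.1, hx.2⟩
      have hy' : y ∈ Ioo lam (lam + eps) := ⟨ht.1.trans_lt hy.1, hy.2⟩
      rw [hD x hx', hD y hy', EReal.coe_le_coe_iff]
      exact hdmono hx' hy' hxy
  refine ⟨?_, fun tz htz htzlim x y hx hy => ?_⟩
  · by_cases hcase : ∃ s ∈ Ioo lam (lam + eps), d s ≤ z
    · obtain ⟨s, hs, hsz⟩ := hcase
      obtain ⟨m, hm, rfl⟩ : z ∈ d '' Ioo lam (lam + eps) :=
        (ordConnected_Ioo.image_hasDerivWithinAt fun x hx =>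
          (hderiv x hx).hasDerivWithinAt).out (mem_image_of_mem d hs) (mem_image_of_mem d hu₀)
          ⟨hsz, hzu₀.le⟩
      refine ⟨m, Ioo_subset_Ico_self hm, tendsto_nhds_unique (hlimD m (Ioo_subset_Ico_self hm)) ?_⟩
      refine (EReal.tendsto_coe.2 (tendsto_right_of_monotoneOn_hasDerivAt hderiv hdmono hm)).congr' ?_
      filter_upwards [Ioo_mem_nhdsGT hm.2] with w hw
      exact (hD w ⟨hm.1.trans hw.1, hw.2⟩).symm
    · push Not at hcase
      refine ⟨lam, ⟨le_rfl, by linarith⟩, le_antisymm hz ?_⟩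
      refine ge_of_tendsto (hlimD lam ⟨le_rfl, by linarith⟩) ?_
      filter_upwards [Ioo_mem_nhdsGT (by linarith : lam < lam + eps)] with w hw
      rw [hD w hw, EReal.coe_le_coe_iff]
      exact (hcase w hw).le
  have hI : ∀ᶠ w in 𝓝[>] tz, w ∈ Ioo tz (lam + eps) := Ioo_mem_nhdsGT htz.2
  have hII : ∀ w ∈ Ioo tz (lam + eps), w ∈ Ioo lam (lam + eps) := fun w hw =>
    ⟨htz.1.trans_lt hw.1, hw.2⟩
  have hdlim : Tendsto d (𝓝[>] tz) (𝓝 z) := by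
    rw [← EReal.tendsto_coe, ← htzlim]
    refine (hlimD tz htz).congr' ?_
    filter_upwards [hI] with w hw using hD w (hII w hw)
  have hzd : ∀ w ∈ Ioo tz (lam + eps), z ≤ d w := fun w hw => by
    refine le_of_tendsto hdlim ?_
    filter_upwards [Ioo_mem_nhdsGT hw.1] with v hv
    exact hdmono (hII v ⟨hv.1, hv.2.trans hw.2⟩) (hII w hw) hv.2.le
  obtain ⟨r, hr⟩ : ∃ r : ℝ, Tendsto f (𝓝[>] tz) (𝓝 (r + tz * z)) := by
    have hmono : MonotoneOn (fun w => f w - w * z) (Ioo tz (lam + eps)) := by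
      intro v hv w hw hvw
      have h1 := hsub v (hII v hv) w
      rw [hf w (hII w hw), EReal.coe_le_coe_iff] at h1
      have h2 := mul_le_mul_of_nonneg_right (hzd v hv) (sub_nonneg.2 hvw)
      change f v - v * z ≤ f w - w * z
      linarith
    obtain ⟨w, hw⟩ := nonempty_Ioo.2 htz.2
    have hbdd : BddBelow ((fun w => f w - w * z) '' Ioo tz (lam + eps)) := by
      refine ⟨f w - w * z - (d w - z) * (w - tz), ?_⟩
      rintro _ ⟨v, hv, rfl⟩
      have h1 := hsub w (hII w hw) v
      rw [hf v (hII v hv), EReal.coe_le_coe_iff] at h1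
      have h2 := mul_nonneg (sub_nonneg.2 (hzd w hw)) (sub_nonneg.2 hv.1.le)
      change _ ≤ f v - v * z
      linarith
    have hlim := hmono.tendsto_nhdsWithin_Ioo_right ⟨w, hw⟩ hbdd
    refine ⟨_, (hlim.add ((tendsto_id.mono_left nhdsWithin_le_nhds).mul_const z)).congr fun v => ?_⟩
    simp
  have hid : Tendsto id (𝓝[>] tz) (𝓝 tz) := tendsto_id.mono_left nhdsWithin_le_nhds
  have hfev : ∀ᶠ w in 𝓝[>] tz, L w = (f w : EReal) ∧ 0 < w := by
    filter_upwards [hI] with w hw using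
      ⟨hf w (hII w hw), (hlam.trans htz.1).trans_lt hw.1⟩
  have hLlim : rightLimE L tz = ((r + tz * z : ℝ) : EReal) :=
    ((EReal.tendsto_coe.2 hr).congr' (hfev.mono fun w hw => hw.1.symm)).limsup_eq
  have hV : rightLimE L tz - (tz : EReal) * (z : EReal) = (r : EReal) := by
    rw [hLlim, ← EReal.coe_mul, ← EReal.coe_sub, add_sub_cancel_right]
  have hle : ∀ t : ℝ, ((r + t * z : ℝ) : EReal) ≤ L t := fun t => by
    have hlim : Tendsto (fun w => f w + d w * (t - w)) (𝓝[>] tz) (𝓝 (r + t * z)) := by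
      have := hr.add (hdlim.mul ((tendsto_const_nhds (x := t)).sub hid))
      rwa [show r + tz * z + z * (t - tz) = r + t * z by ring] at this
    refine le_of_tendsto (EReal.tendsto_coe.2 hlim) ?_
    filter_upwards [hI] with w hw using hsub w (hII w hw) t
  have hLeg : LegendreEE L z = ((-r : ℝ) : EReal) :=
    legendreEE_eq_of_tendsto hle (hfev.mono fun w hw => hw.1) hid hr
  have hInf := iInf_sub_eq_of_tendsto hle hfev hid hr
  have hupper : limsup (fun i => elog (c i) (muIccE (μ i) (x i) (y i))) lf ≤ (r : EReal) := by
    refine EReal.le_of_forall_lt_iff_le.1 fun w hw => ?_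
    rw [EReal.coe_lt_coe_iff] at hw
    have hlim : Tendsto (fun t => f t - t * z) (𝓝[>] tz) (𝓝 r) := by
      have := hr.sub (hid.mul_const z)
      rwa [add_sub_cancel_right] at this
    obtain ⟨t, htw, hft, ht0⟩ := ((hlim.eventually_lt_const hw).and hfev).exists
    set η := (w - (f t - t * z)) / 2
    have hη : 0 < η := half_pos (sub_pos.2 htw)
    have ha : z - η / t < z := sub_lt_self z (div_pos hη ht0)
    refine (limsup_elog_Icc_le hc ht0.le (b := f t + η) (a := z - η / t) ?_
      (hx.eventually_const_lt (EReal.coe_lt_coe_iff.2 ha))).trans_eq ?_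
    · change L t < _
      rw [hft, EReal.coe_lt_coe_iff]
      linarith
    · congr 1
      rw [mul_sub, mul_div_cancel₀ _ ht0.ne']
      simp only [η]
      ring
  have hlower : (r : EReal) ≤ limsup (fun i => elog (c i) (muIooE (μ i) (x i) (y i))) lf := by
    refine EReal.ge_of_forall_gt_iff_ge.1 fun w hw => ?_
    rw [EReal.coe_lt_coe_iff] at hw
    obtain ⟨Y, hzY, hY⟩ := EReal.lt_iff_exists_real_btwn.1 hy
    rw [EReal.coe_lt_coe_iff] at hzY
    have hB : 0 < lam + eps := by linarith
    obtain ⟨b, hzb, hb⟩ : ∃ b, z < b ∧ b < min Y (z + (r - w) / (lam + eps)) :=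
      exists_between (lt_min hzY (lt_add_of_pos_right z (div_pos (sub_pos.2 hw) hB)))
    obtain ⟨hbY, hbw⟩ := lt_min_iff.1 hb
    obtain ⟨t, ht, hzt, htb⟩ : ∃ t ∈ Ioo lam (lam + eps), z < d t ∧ d t < b := by
      obtain ⟨s, hsb, hs⟩ := ((hdlim.eventually_lt_const hzb).and hI).exists
      obtain ⟨v, hv, hvb⟩ := exists_between (lt_min hzb hzu₀)
      by_cases hsv : d s ≤ v
      · obtain ⟨m, hm, rfl⟩ : v ∈ d '' Ioo lam (lam + eps) :=
          (ordConnected_Ioo.image_hasDerivWithinAt fun x hx =>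
            (hderiv x hx).hasDerivWithinAt).out (mem_image_of_mem d (hII s hs))
            (mem_image_of_mem d hu₀) ⟨hsv, (hvb.trans_le (min_le_right _ _)).le⟩
        exact ⟨m, hm, hv, hvb.trans_le (min_le_left _ _)⟩
      · exact ⟨s, hII s hs, hv.trans (not_le.1 hsv), hsb⟩
    obtain ⟨a, hza, hat⟩ := exists_between hzt
    have ht0 : 0 < t := hlam.trans_lt ht.1
    obtain ⟨u, hu, hut, hfu⟩ : ∃ u ∈ Ioo lam (lam + eps), u < t ∧ f u + (t - u) * a < f t :=
      exists_left_lt_of_lt_deriv (hderiv t ht) (isOpen_Ioo.mem_nhds ht) hat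
    obtain ⟨v, hv, htv, hfv⟩ : ∃ v ∈ Ioo lam (lam + eps), t < v ∧ f v - (v - t) * b < f t :=
      exists_right_lt_of_deriv_lt (hderiv t ht) (isOpen_Ioo.mem_nhds ht) htb
    have hbound := le_limsup_elog_Ioo hc hc0 ht0.le hut.le htv.le (hf u hu) (hf t ht) (hf v hv)
      hfu hfv
    have hmono : limsup (fun i => elog (c i) (μ i (Ioo a b))) lf
        ≤ limsup (fun i => elog (c i) (muIooE (μ i) (x i) (y i))) lf := by
      refine limsup_le_limsup ?_
      filter_upwards [hx.eventually_lt_const (EReal.coe_lt_coe_iff.2 hza),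
        Filter.eventually_lt_of_lt_liminf hY] with i hxi hyi
      refine elog_mono (hc i) (measure_mono fun q hq => ⟨?_, ?_⟩)
      · exact hxi.trans (EReal.coe_lt_coe_iff.2 hq.1)
      · exact (EReal.coe_lt_coe_iff.2 (hq.2.trans hbY)).trans hyi
    refine le_trans (EReal.coe_le_coe_iff.2 ?_) (hbound.trans hmono)
    have h1 := hle t
    rw [hf t ht, EReal.coe_le_coe_iff] at h1
    have h2 : (b - z) * (lam + eps) < r - w := by
      rw [← lt_div_iff₀ hB]
      linarith
    have h3 := mul_le_mul_of_nonneg_left ht.2.le (sub_nonneg.2 hzb.le)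
    linarith
  have hmid : limsup (fun i => elog (c i) (muIooE (μ i) (x i) (y i))) lf
      ≤ limsup (fun i => elog (c i) (muIccE (μ i) (x i) (y i))) lf :=
    limsup_le_limsup (Eventually.of_forall fun i =>
      elog_mono (hc i) (measure_mono fun q hq => ⟨hq.1.le, hq.2.le⟩))
  rw [hV, hInf, hLeg, EReal.coe_neg, neg_neg]
  exact ⟨le_antisymm hupper (hlower.trans hmid), le_antisymm (hmid.trans hupper) hlower, rfl, rfl⟩
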